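/- arXiv:1812.01326 — 6 statements merged into one kernel-verified Lean document; each statement's English description precedes it below -/
import Mathlib

section
/- For q ∈ ℂ with |q| < 1, the infinite product ∏_{n=1}^∞ (1 − qⁿ)²⁴ converges (absolutely and locally uniformly on the open unit disc), so Δ̃(q) := q · ∏_{n=1}^∞ (1 − qⁿ)²⁴ defines a holomorphic function on the open unit disc. Moreover, the series ∑_{n≥1} σ₁(n) qⁿ converges absolutely for |q| < 1, and for every q with |q| < 1 one has q · Δ̃′(q) = ( 1 − 24 ∑_{n≥1} σ₁(n) qⁿ ) · Δ̃(q). -/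
open ModularForm Metric

lemma one_sub_pow_succ_ne_zero {q : ℂ} (hq : ‖q‖ < 1) (n : ℕ) : 1 - q ^ (n + 1) ≠ 0 := by
  intro h
  have h1 : ‖q ^ (n + 1)‖ < 1 := by
    simpa using pow_lt_one₀ (norm_nonneg q) hq n.succ_ne_zero
  rw [← sub_eq_zero.mp h] at h1
  simp at h1

lemma tprod_one_sub_pow_ne_zero {q : ℂ} (hq : ‖q‖ < 1) : ∏' n : ℕ, (1 - q ^ (n + 1)) ≠ 0 := by
  simp only [sub_eq_add_neg]
  refine tprod_one_add_ne_zero_of_summable (f := fun n : ℕ ↦ -q ^ (n + 1)) (fun n ↦ ?_) ?_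
  · simpa [sub_eq_add_neg] using one_sub_pow_succ_ne_zero hq n
  · simpa using (summable_nat_add_iff 1).mpr (summable_geometric_of_lt_one (norm_nonneg _) hq)

lemma logDeriv_one_sub_pow_succ (q : ℂ) (n : ℕ) :
    logDeriv (fun w : ℂ ↦ 1 - w ^ (n + 1)) q = -((n + 1) * q ^ n / (1 - q ^ (n + 1))) := by
  simp [logDeriv_apply, neg_div]

/-- The Lambert series `∑ n qⁿ / (1 - qⁿ)` equals `∑ σ₁(n) qⁿ`. -/
lemma tsum_lambert_eq_tsum_sum_divisors {q : ℂ} (hq : ‖q‖ < 1) :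
    ∑' n : ℕ, (n + 1) * q ^ (n + 1) / (1 - q ^ (n + 1)) =
      ∑' n : ℕ, (∑ d ∈ (n + 1).divisors, (d : ℂ)) * q ^ (n + 1) := by
  have h := tsum_pow_div_one_sub_eq_tsum_sigma hq 1
  rw [tsum_pnat_eq_tsum_succ (f := fun n : ℕ ↦ (n : ℂ) ^ 1 * q ^ n / (1 - q ^ n)),
    tsum_pnat_eq_tsum_succ
      (f := fun n : ℕ ↦ (ArithmeticFunction.sigma 1 n : ℂ) * q ^ n)] at h
  simpa [ArithmeticFunction.sigma_one_apply] using h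

lemma summable_norm_sum_divisors_mul_pow {q : ℂ} (hq : ‖q‖ < 1) :
    Summable fun n : ℕ ↦ ‖(∑ d ∈ (n + 1).divisors, (d : ℂ)) * q ^ (n + 1)‖ := by
  refine .of_nonneg_of_le (fun _ ↦ norm_nonneg _) (fun n ↦ ?_)
    ((summable_nat_add_iff 1).mpr (summable_norm_pow_mul_geometric_of_norm_lt_one 2 hq))
  rw [norm_mul, norm_mul]
  gcongr
  calc ‖∑ d ∈ (n + 1).divisors, (d : ℂ)‖ ≤ ∑ d ∈ (n + 1).divisors, ((n + 1 : ℕ) : ℝ) := by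
        refine norm_sum_le_of_le _ fun d hd ↦ ?_
        simpa only [Complex.norm_natCast, Nat.cast_le] using Nat.divisor_le hd
    _ ≤ ((n + 1 : ℕ) : ℝ) * ((n + 1 : ℕ) : ℝ) := by
        rw [Finset.sum_const, nsmul_eq_mul]
        gcongr
        exact Nat.card_divisors_le_self _
    _ = ‖((n + 1 : ℕ) : ℂ) ^ 2‖ := by rw [norm_pow, Complex.norm_natCast, sq]

lemma summable_logDeriv_one_sub_pow_succ {q : ℂ} (hq : ‖q‖ < 1) :
    Summable fun n : ℕ ↦ logDeriv (fun w : ℂ ↦ 1 - w ^ (n + 1)) q := by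
  simp only [logDeriv_one_sub_pow_succ]
  rcases eq_or_ne q 0 with rfl | hq0
  · exact summable_of_ne_finset_zero (s := {0}) fun n hn ↦ by simp_all
  · have h := (summable_nat_add_iff (f := fun n : ℕ ↦ (n : ℂ) ^ 1 * q ^ n / (1 - q ^ n)) 1).mpr
      (summable_norm_pow_mul_geometric_div_one_sub 1 hq)
    refine (h.mul_left (-q⁻¹)).congr fun n ↦ ?_
    have := one_sub_pow_succ_ne_zero hq n
    push_cast
    field_simp
    ring

lemma mul_deriv_tprod_one_sub_pow {q : ℂ} (hq : ‖q‖ < 1) :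
    q * deriv (fun w : ℂ ↦ ∏' n : ℕ, (1 - w ^ (n + 1))) q =
      -(∑' n : ℕ, (∑ d ∈ (n + 1).divisors, (d : ℂ)) * q ^ (n + 1)) *
        ∏' n : ℕ, (1 - q ^ (n + 1)) := by
  have hP := tprod_one_sub_pow_ne_zero hq
  have h := logDeriv_tprod_eq_tsum isOpen_ball (mem_ball_zero_iff.mpr hq)
    (one_sub_pow_succ_ne_zero hq) (fun _ ↦ by fun_prop) (summable_logDeriv_one_sub_pow_succ hq)
    multipliableLocallyUniformlyOn_one_sub_pow hP
  rw [logDeriv_apply, div_eq_iff hP] at h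
  rw [h, ← mul_assoc, ← tsum_mul_left, ← tsum_lambert_eq_tsum_sum_divisors hq, ← tsum_neg]
  congr 1
  refine tsum_congr fun n ↦ ?_
  rw [logDeriv_one_sub_pow_succ]
  ring

/-- On the open unit disc, `∏_{n ≥ 1} (1 - qⁿ)²⁴` converges, so
`Δ̃(q) = q · ∏_{n ≥ 1} (1 - qⁿ)²⁴` is holomorphic there; moreover `∑ σ₁(n) qⁿ`
converges absolutely and `q · Δ̃'(q) = (1 - 24 ∑_{n ≥ 1} σ₁(n) qⁿ) · Δ̃(q)`. -/
theorem stmt2 :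
    (∀ q : ℂ, ‖q‖ < 1 → Multipliable fun n : ℕ => (1 - q ^ (n + 1)) ^ 24) ∧
    DifferentiableOn ℂ
      (fun q : ℂ => q * ∏' n : ℕ, (1 - q ^ (n + 1)) ^ 24) (Metric.ball 0 1) ∧
    (∀ q : ℂ, ‖q‖ < 1 →
      Summable fun n : ℕ => ‖(∑ d ∈ (n + 1).divisors, (d : ℂ)) * q ^ (n + 1)‖) ∧
    (∀ q : ℂ, ‖q‖ < 1 →
      q * deriv (fun w : ℂ => w * ∏' n : ℕ, (1 - w ^ (n + 1)) ^ 24) q =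
        (1 - 24 * ∑' n : ℕ, (∑ d ∈ (n + 1).divisors, (d : ℂ)) * q ^ (n + 1)) *
          (q * ∏' n : ℕ, (1 - q ^ (n + 1)) ^ 24)) := by
  have hdiff := differentiableOn_tprod_one_sub_pow_pow 24
  refine ⟨fun q hq ↦ (multipliable_one_sub_pow hq).pow 24, by fun_prop,
    fun q hq ↦ summable_norm_sum_divisors_mul_pow hq, fun q hq ↦ ?_⟩
  have hmem : ball (0 : ℂ) 1 ∈ nhds q := isOpen_ball.mem_nhds (mem_ball_zero_iff.mpr hq)
  have hP := (differentiableOn_tprod_one_sub_pow.differentiableAt hmem).hasDerivAt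
  have heq : (fun w : ℂ ↦ w * ∏' n : ℕ, (1 - w ^ (n + 1)) ^ 24) =ᶠ[nhds q]
      fun w ↦ w * (∏' n : ℕ, (1 - w ^ (n + 1))) ^ 24 := by
    filter_upwards [hmem] with w hw
    rw [(multipliable_one_sub_pow (mem_ball_zero_iff.mp hw)).tprod_pow]
  rw [heq.deriv_eq, ((hasDerivAt_id' q).fun_mul (hP.fun_pow 24)).deriv,
    (multipliable_one_sub_pow hq).tprod_pow]
  push_cast
  linear_combination
    24 * q * (∏' n : ℕ, (1 - q ^ (n + 1))) ^ 23 * mul_deriv_tprod_one_sub_pow hq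
end

section
/- Let N > 1 be an integer and let a : ℕ → ℂ be a function with a(d) = 0 unless d is a divisor of N with d ≠ 1. Suppose that for every integer n ≥ 1, ∑_{d ∣ N, d ≠ 1} a(d) · ( σ₁(n) − d·σ₁(n/d) ) = 0, where σ₁(n/d) is interpreted as 0 when d does not divide n. Then a(d) = 0 for every d. (Equivalently: the q-expansions of the weight-2 forms E₂(z) − d·E₂(dz), as d ranges over the divisors of N with d ≠ 1, are linearly independent over ℂ.) -/
/-- If a linear combination `∑_{d ∣ N, d ≠ 1} a d · (σ₁(n) - d·σ₁(n/d))`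
vanishes for every `n ≥ 1` (with `σ₁(n/d) = 0` when `d ∤ n`), and `a` is supported on
divisors `d ≠ 1` of `N`, then `a = 0`; i.e. the q-expansions of `E₂(z) - d·E₂(dz)` are
linearly independent. -/
theorem stmt3 (N : ℕ) (hN : 1 < N) (a : ℕ → ℂ)
    (ha : ∀ d : ℕ, ¬(d ∣ N ∧ d ≠ 1) → a d = 0)
    (h : ∀ n : ℕ, 1 ≤ n →
      ∑ d ∈ N.divisors.erase 1, a d *
        ((∑ e ∈ n.divisors, (e : ℂ)) -
          (d : ℂ) * (if d ∣ n then ∑ e ∈ (n / d).divisors, (e : ℂ) else 0)) = 0) :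
    ∀ d : ℕ, a d = 0 := by
  have hsum : ∑ d ∈ N.divisors.erase 1, a d = 0 := by
    rw [← h 1 le_rfl]
    refine Finset.sum_congr rfl fun d hd => ?_
    have hd1 : ¬ d ∣ 1 := by simpa using (Finset.mem_erase.mp hd).1
    simp [hd1]
  have hconv : ∀ n : ℕ, 1 ≤ n → ∑ d ∈ N.divisors.erase 1,
      a d * ((d : ℂ) * (if d ∣ n then ∑ e ∈ (n / d).divisors, (e : ℂ) else 0)) = 0 := by
    intro n hn
    have hn' := h n hn
    simp only [mul_sub, Finset.sum_sub_distrib] at hn'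
    rw [← Finset.sum_mul, hsum, zero_mul, zero_sub, neg_eq_zero] at hn'
    exact hn'
  intro n
  induction n using Nat.strong_induction_on with
  | _ n ih =>
    by_cases hn : n ∣ N ∧ n ≠ 1
    · have hpos : 0 < n := Nat.pos_of_dvd_of_pos hn.1 (by omega)
      have hmem : n ∈ N.divisors.erase 1 :=
        Finset.mem_erase.mpr ⟨hn.2, Nat.mem_divisors.mpr ⟨hn.1, by omega⟩⟩
      have hc := hconv n hpos
      rw [Finset.sum_eq_single_of_mem n hmem] at hc
      · simpa [Nat.div_self hpos, hpos.ne'] using hc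
      · intro d _ hdn
        by_cases hd : d ∣ n
        · rw [ih d (lt_of_le_of_ne (Nat.le_of_dvd hpos hd) hdn), zero_mul]
        · simp [hd]
    · exact ha n hn
end

section
/- Let a and c be positive integers and set g := gcd(a, c). Then there exist a matrix γ ∈ SL₂(ℤ) and an integer μ such that, as products of 2×2 integer matrices, [[a, 0], [0, 1]] · [[1, 0], [c, 1]] = γ · [[1, μ], [0, a/g]] · [[g, 0], [0, 1]]. -/
/-- For positive integers `a, c` with `g = gcd(a, c)`, there are
`γ ∈ SL₂(ℤ)` and `μ ∈ ℤ` with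
`[[a,0],[0,1]]·[[1,0],[c,1]] = γ·[[1,μ],[0,a/g]]·[[g,0],[0,1]]`. -/
theorem stmt5 (a c : ℤ) (ha : 0 < a) (hc : 0 < c) :
    ∃ (γ : Matrix.SpecialLinearGroup (Fin 2) ℤ) (μ : ℤ),
      !![a, 0; 0, 1] * !![1, 0; c, 1] =
        (γ : Matrix (Fin 2) (Fin 2) ℤ) * !![1, μ; 0, a / (Int.gcd a c : ℤ)] *
          !![(Int.gcd a c : ℤ), 0; 0, 1] := by
  have hbez := Int.gcd_eq_gcd_ab a c
  have hg : (Int.gcd a c : ℤ) ≠ 0 := by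
    exact_mod_cast (Int.gcd_pos_of_ne_zero_left c ha.ne').ne'
  obtain ⟨a', ha'⟩ := Int.gcd_dvd_left a c
  obtain ⟨c', hc'⟩ := Int.gcd_dvd_right a c
  have hdiv : a / (Int.gcd a c : ℤ) = a' := Int.ediv_eq_of_eq_mul_right hg ha'
  rw [hdiv]
  generalize (Int.gcd a c : ℤ) = g at *
  generalize Int.gcdA a c = x at *
  generalize Int.gcdB a c = y at *
  have h1 : a' * x + c' * y = 1 := by
    apply mul_left_cancel₀ hg
    linear_combination -hbez - x * ha' - y * hc'
  refine ⟨⟨!![a', -y; c', x], by rw [Matrix.det_fin_two_of]; linear_combination h1⟩, y, ?_⟩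
  ext i j
  fin_cases i <;> fin_cases j <;> simp [Matrix.mul_apply, Fin.sum_univ_two]
  · linear_combination ha'
  · ring
  · linear_combination hc'
  · linear_combination -h1
end

section
/- Define E : ℍ → ℂ by E(z) := 1 − 24 ∑_{n≥1} σ₁(n) e^{2πinz} (the series converges absolutely for z ∈ ℍ). Let N ≥ 1 be an integer and let d be a positive divisor of N. Then for every γ = [[a, b], [c, d′]] ∈ SL₂(ℤ) with N ∣ c, and every z ∈ ℍ, E(γ·z) − d · E(d · (γ·z)) = (cz + d′)² · ( E(z) − d · E(dz) ). -/
open UpperHalfPlane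

open EisensteinSeries in
/-- The quasi-modular transformation law of `E2`, written pointwise. -/
lemma E2_smul_eq (γ : Matrix.SpecialLinearGroup (Fin 2) ℤ) (z : UpperHalfPlane) :
    E2 (γ • z) = ((γ 1 0 : ℂ) * (z : ℂ) + (γ 1 1 : ℂ)) ^ 2 * E2 z -
      1 / (2 * riemannZeta 2) * (2 * Real.pi * Complex.I) * (γ 1 0 : ℂ) *
        ((γ 1 0 : ℂ) * (z : ℂ) + (γ 1 1 : ℂ)) := by
  have h := congrFun (E2_slash_action γ) z
  have hne := denom_ne_zero γ z
  rw [ModularForm.SL_slash_apply] at h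
  simp only [Pi.sub_apply, Pi.smul_apply, smul_eq_mul, D2, ModularGroup.denom_apply] at h hne
  rw [zpow_neg, ← div_eq_mul_inv, div_eq_iff (zpow_ne_zero _ hne)] at h
  rw [h, show ((2 : ℤ)) = ((2 : ℕ) : ℤ) from rfl, zpow_natCast]
  generalize 1 / (2 * riemannZeta 2) = K
  field_simp

/-- The `q`-expansion of `E2`, indexed by the natural numbers. -/
lemma E2_eq_one_sub_tsum_divisors (z : UpperHalfPlane) :
    EisensteinSeries.E2 z = 1 - 24 * ∑' n : ℕ, (∑ d ∈ (n + 1).divisors, (d : ℂ)) *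
      Complex.exp (2 * Real.pi * Complex.I * (n + 1) * z) := by
  rw [EisensteinSeries.E2_eq_tsum_cexp, tsum_pnat_eq_tsum_succ
    (f := fun n : ℕ ↦ (ArithmeticFunction.sigma 1 n : ℂ) *
      Complex.exp (2 * Real.pi * Complex.I * z) ^ n)]
  congr 2
  refine tsum_congr fun n ↦ ?_
  rw [ArithmeticFunction.sigma_one_apply, ← Complex.exp_nat_mul]
  push_cast
  ring_nf

/-- For `d ∣ c`, the conjugate `[[a, d b], [c / d, d']]` of `γ` by `diag(d, 1)`. -/
lemma exists_conj_diag (γ : Matrix.SpecialLinearGroup (Fin 2) ℤ) {d : ℕ}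
    (h : (d : ℤ) ∣ γ 1 0) : ∃ γ' : Matrix.SpecialLinearGroup (Fin 2) ℤ,
      γ 1 0 = d * γ' 1 0 ∧ γ' 1 1 = γ 1 1 ∧
      ∀ z w : UpperHalfPlane, (w : ℂ) = d * z →
        ((γ' • w : UpperHalfPlane) : ℂ) = d * ((γ • z : UpperHalfPlane) : ℂ) := by
  obtain ⟨e, he⟩ := h
  have hdet := γ.det_coe
  rw [Matrix.det_fin_two, he] at hdet
  obtain ⟨γ', h00, h01, h10, h11⟩ : ∃ γ' : Matrix.SpecialLinearGroup (Fin 2) ℤ,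
      γ' 0 0 = γ 0 0 ∧ γ' 0 1 = d * γ 0 1 ∧ γ' 1 0 = e ∧ γ' 1 1 = γ 1 1 := by
    refine ⟨⟨!![γ 0 0, d * γ 0 1; e, γ 1 1], ?_⟩, rfl, rfl, rfl, rfl⟩
    rw [Matrix.det_fin_two_of]
    linear_combination hdet
  refine ⟨γ', by rw [he, h10], h11, fun z w hw ↦ ?_⟩
  rw [coe_specialLinearGroup_apply, coe_specialLinearGroup_apply, hw, he, h00, h01, h10, h11]
  push_cast [algebraMap_int_eq, eq_intCast]
  ring

/-- For the weight-2 Eisenstein series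
`E(z) = 1 - 24 ∑_{n ≥ 1} σ₁(n) e^{2πinz}`, a divisor `d` of `N` and
`γ ∈ Γ₀(N)`, one has `E(γ·z) - d·E(d·(γ·z)) = (cz + d′)²·(E(z) - d·E(dz))`. -/
theorem stmt9 (E : ℂ → ℂ)
    (hE : ∀ z : ℂ, 0 < z.im →
      E z = 1 - 24 * ∑' n : ℕ, (∑ d ∈ (n + 1).divisors, (d : ℂ)) *
        Complex.exp (2 * Real.pi * Complex.I * (n + 1) * z))
    (N : ℕ) (hN : 1 ≤ N) (d : ℕ) (hd : 0 < d) (hdN : d ∣ N)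
    (γ : Matrix.SpecialLinearGroup (Fin 2) ℤ) (hγ : (N : ℤ) ∣ γ 1 0)
    (z : UpperHalfPlane) :
    E ((γ • z : UpperHalfPlane) : ℂ) -
        (d : ℂ) * E ((d : ℂ) * ((γ • z : UpperHalfPlane) : ℂ)) =
      ((γ 1 0 : ℂ) * (z : ℂ) + (γ 1 1 : ℂ)) ^ 2 *
        (E (z : ℂ) - (d : ℂ) * E ((d : ℂ) * (z : ℂ))) := by
  have hE2 (w : UpperHalfPlane) : E w = EisensteinSeries.E2 w := by
    rw [hE w w.im_pos, E2_eq_one_sub_tsum_divisors]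
  obtain ⟨γ', hc, hd', hsmul⟩ :=
    exists_conj_diag γ ((Int.natCast_dvd_natCast.mpr hdN).trans hγ)
  have him : 0 < ((d : ℂ) * (z : ℂ)).im := by
    simpa using mul_pos (Nat.cast_pos.mpr hd) z.im_pos
  let w : UpperHalfPlane := ⟨(d : ℂ) * z, him⟩
  have hw : (w : ℂ) = d * z := rfl
  rw [← hsmul z w hw, ← hw, hE2, hE2, hE2, hE2, E2_smul_eq γ z, E2_smul_eq γ' w, hw, hd', hc]
  push_cast
  ring
end

section
/- Define E : ℍ → ℂ by E(z) := 1 − 24 ∑_{n≥1} σ₁(n) e^{2πinz} (the series converges absolutely for z ∈ ℍ). Let d and c be positive integers and set g := gcd(d, c). Then there exists an integer μ such that for every z ∈ ℍ (writing w := z/(cz + 1), which lies in ℍ), (cz + 1)^{−2} · ( E(w) − d · E(d·w) ) = E(z) − (g²/d) · E( (g² z + μ g)/d ). -/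
open EisensteinSeries UpperHalfPlane in
/-- The transformation law of `E2` under `SL(2, ℤ)`, in terms of complex numbers. -/
lemma E2_linear_fractional (a b c d : ℤ) (h : a * d - b * c = 1) (τ τ' : ℍ)
    (hτ : (τ' : ℂ) = (a * τ + b) / (c * τ + d)) :
    E2 τ' = ((c : ℂ) * τ + d) ^ 2 * E2 τ -
      1 / (2 * riemannZeta 2) * (2 * Real.pi * Complex.I * c) * (c * τ + d) := by
  let γ : Matrix.SpecialLinearGroup (Fin 2) ℤ := ⟨!![a, b; c, d], by simpa using h⟩
  have hden : denom γ τ = (c : ℂ) * τ + d := ModularGroup.denom_apply γ τ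
  have hne : (c : ℂ) * τ + d ≠ 0 := hden ▸ denom_ne_zero γ τ
  have hsmul : γ • τ = τ' := by
    ext
    rw [hτ, UpperHalfPlane.coe_specialLinearGroup_apply]
    simp [γ]
  have key := congrFun (E2_slash_action γ) τ
  rw [ModularForm.SL_slash_apply, hden, hsmul] at key
  simp only [Pi.sub_apply, Pi.smul_apply, D2, hden, smul_eq_mul] at key
  have hc : γ 1 0 = c := rfl
  rw [hc, zpow_neg, ← div_eq_mul_inv, div_eq_iff (zpow_ne_zero _ hne)] at key
  rw [key, zpow_ofNat]
  field_simp

open EisensteinSeries UpperHalfPlane in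
/-- The `q`-expansion of `E2`, indexed by the natural numbers. -/
lemma E2_eq_tsum_divisors (τ : ℍ) :
    E2 τ = 1 - 24 * ∑' n : ℕ, (∑ d ∈ (n + 1).divisors, (d : ℂ)) *
        Complex.exp (2 * Real.pi * Complex.I * (n + 1) * τ) := by
  rw [E2_eq_tsum_cexp, tsum_pnat_eq_tsum_succ
    (f := fun n : ℕ ↦ (ArithmeticFunction.sigma 1 n : ℂ) *
      Complex.exp (2 * Real.pi * Complex.I * τ) ^ n)]
  refine congrArg (1 - 24 * ·) (tsum_congr fun n ↦ ?_)
  rw [← Complex.exp_nat_mul, ArithmeticFunction.sigma_one_apply]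
  push_cast
  ring_nf

/-- With `E` the weight-2 Eisenstein series, `d, c` positive integers and
`g = gcd(d, c)`, there is `μ ∈ ℤ` so that for all `z ∈ ℍ`, writing `w = z/(cz+1)`,
`(cz+1)⁻² (E(w) - d·E(dw)) = E(z) - (g²/d)·E((g²z + μg)/d)`. -/
theorem stmt10 (E : ℂ → ℂ)
    (hE : ∀ z : ℂ, 0 < z.im →
      E z = 1 - 24 * ∑' n : ℕ, (∑ d ∈ (n + 1).divisors, (d : ℂ)) *
        Complex.exp (2 * Real.pi * Complex.I * (n + 1) * z))
    (d c : ℕ) (hd : 0 < d) (hc : 0 < c) :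
    ∃ μ : ℤ, ∀ z : ℂ, 0 < z.im →
      ((c : ℂ) * z + 1) ^ (-2 : ℤ) *
          (E (z / ((c : ℂ) * z + 1)) -
            (d : ℂ) * E ((d : ℂ) * (z / ((c : ℂ) * z + 1)))) =
        E z - ((Nat.gcd d c : ℂ) ^ 2 / (d : ℂ)) *
          E (((Nat.gcd d c : ℂ) ^ 2 * z + (μ : ℂ) * (Nat.gcd d c : ℂ)) / (d : ℂ)) := by
  have hE2 (τ : UpperHalfPlane) : E τ = EisensteinSeries.E2 τ := by
    rw [hE τ τ.im_pos, E2_eq_tsum_divisors]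
  obtain ⟨g, hg⟩ : ∃ g, g = Nat.gcd d c := ⟨_, rfl⟩
  have hg0 : 0 < g := hg ▸ Nat.gcd_pos_of_pos_left c hd
  obtain ⟨d', c', hcop, hd', hc'⟩ := Nat.exists_coprime d c
  rw [← hg] at hd' hc'
  have hd'0 : 0 < d' := Nat.pos_of_mul_pos_right (hd' ▸ hd)
  have hgC : (g : ℂ) ≠ 0 := by exact_mod_cast hg0.ne'
  have hdC : (d' : ℂ) ≠ 0 := by exact_mod_cast hd'0.ne'
  obtain ⟨δ, μ, hδμ⟩ := Nat.isCoprime_iff_coprime.2 hcop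
  have hδμC : (δ * d' + μ * c' : ℂ) = 1 := by exact_mod_cast hδμ
  refine ⟨μ, fun z hz ↦ ?_⟩
  rw [← hg]
  have hne : (c : ℂ) * z + 1 ≠ 0 := by
    intro h
    have := congrArg Complex.im h
    simp [hc.ne', hz.ne'] at this
  have hw : 0 < (z / ((c : ℂ) * z + 1)).im := by
    have : (z / ((c : ℂ) * z + 1)).im = z.im / Complex.normSq ((c : ℂ) * z + 1) := by
      rw [Complex.div_im]
      simp
      ring
    rw [this]
    exact div_pos hz (Complex.normSq_pos.2 hne)
  have hdw : 0 < ((d : ℂ) * (z / ((c : ℂ) * z + 1))).im := by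
    rw [← Complex.ofReal_natCast, Complex.im_ofReal_mul]
    positivity
  have hτ_eq : ((g : ℂ) ^ 2 * z + μ * g) / d = (g * z + μ) / d' := by
    rw [hd']
    push_cast
    field_simp
  have hτ : 0 < (((g : ℂ) ^ 2 * z + μ * g) / d).im := by
    rw [hτ_eq, ← Complex.ofReal_natCast d', Complex.div_ofReal_im]
    simp
    positivity
  have h₁ := E2_linear_fractional 1 0 c 1 (by simp) ⟨z, hz⟩ ⟨_, hw⟩ (by simp)
  have hfac : (c' : ℂ) * ((g * z + μ) / d') + δ = (c * z + 1) / d' := by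
    rw [hc', ← hδμC]
    push_cast
    field_simp
    ring
  have hdw_eq : (d : ℂ) * (z / (c * z + 1)) =
      (d' * ((g * z + μ) / d') + -μ) / (c' * ((g * z + μ) / d') + δ) := by
    rw [hfac, hd']
    push_cast
    field_simp
    ring
  have h₂ := E2_linear_fractional d' (-μ) c' δ (by linear_combination hδμ) ⟨_, hτ⟩ ⟨_, hdw⟩
    (by simpa [hτ_eq] using hdw_eq)
  rw [← hE2, ← hE2] at h₁ h₂
  simp only [Int.cast_natCast, Int.cast_one] at h₁ h₂
  rw [h₁, h₂, hτ_eq, hfac, zpow_neg, zpow_ofNat]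
  generalize (1 / (2 * riemannZeta 2) : ℂ) = K
  have hcC : (c : ℂ) = c' * g := by exact_mod_cast hc'
  have hdgC : (d : ℂ) = d' * g := by exact_mod_cast hd'
  generalize E z = A
  generalize E _ = B
  rw [hdgC]
  generalize (c : ℂ) * z + 1 = u at hne ⊢
  rw [hcC]
  field_simp
  ring
end

section
/- Define E : ℍ → ℂ by E(z) := 1 − 24 ∑_{n≥1} σ₁(n) e^{2πinz} (the series converges absolutely for z ∈ ℍ). Let d and c be positive integers and fix x ∈ ℝ. Then, with z = x + iy and w := z/(cz + 1), lim_{y → ∞} (cz + 1)^{−2} · ( E(w) − d · E(d·w) ) = 1 − gcd(c, d)²/d. -/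
open UpperHalfPlane in
/-- The `q`-expansion of `E2` at a point of `ℂ` with positive imaginary part. -/
lemma E2_ofComplex_eq_tsum {z : ℂ} (hz : 0 < z.im) :
    EisensteinSeries.E2 (ofComplex z) =
      1 - 24 * ∑' n : ℕ, (∑ d ∈ (n + 1).divisors, (d : ℂ)) *
        Complex.exp (2 * Real.pi * Complex.I * (n + 1) * z) := by
  rw [EisensteinSeries.E2_eq_tsum_cexp, ofComplex_apply_of_im_pos hz,
    tsum_pnat_eq_tsum_succ (f := fun n ↦ (ArithmeticFunction.sigma 1 n : ℂ) *
      Complex.exp (2 * Real.pi * Complex.I * z) ^ n)]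
  congr 2
  refine tsum_congr fun n ↦ ?_
  rw [ArithmeticFunction.sigma_one_apply, ← Complex.exp_nat_mul]
  push_cast
  ring_nf

open UpperHalfPlane in
lemma tendsto_E2_ofComplex :
    Filter.Tendsto (fun z : ℂ ↦ EisensteinSeries.E2 (ofComplex z))
      (Filter.comap Complex.im Filter.atTop) (nhds 1) := by
  have him : Filter.Tendsto Complex.im (Filter.comap Complex.im Filter.atTop) Filter.atTop :=
    Filter.tendsto_comap
  have hnorm (n : ℕ) (z : ℂ) :
      ‖(∑ d ∈ (n + 1).divisors, (d : ℂ)) *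
        Complex.exp (2 * Real.pi * Complex.I * (n + 1) * z)‖ =
      (∑ d ∈ (n + 1).divisors, (d : ℝ)) * Real.exp (-(2 * Real.pi * (n + 1) * z.im)) := by
    rw [norm_mul, Complex.norm_exp]
    congr 1
    · rw [← Nat.cast_sum, Complex.norm_natCast, Nat.cast_sum]
    · simp [mul_assoc]
  have hsum : Summable fun n : ℕ ↦
      (∑ d ∈ (n + 1).divisors, (d : ℝ)) * Real.exp (-(2 * Real.pi * (n + 1) * 1)) := by
    have h := ((summable_nat_add_iff 1).mpr
      (EisensteinSeries.summable_sigma_mul_cexp_pow (k := 2) one_le_two I)).norm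
    refine h.congr fun n ↦ ?_
    have hn := hnorm n Complex.I
    rw [Complex.I_im] at hn
    rw [← hn, show 2 - 1 = 1 from rfl, ArithmeticFunction.sigma_one_apply,
      ← Complex.exp_nat_mul]
    push_cast
    ring_nf
  have hlim : Filter.Tendsto (fun z : ℂ ↦ ∑' n : ℕ, (∑ d ∈ (n + 1).divisors, (d : ℂ)) *
      Complex.exp (2 * Real.pi * Complex.I * (n + 1) * z))
      (Filter.comap Complex.im Filter.atTop) (nhds (∑' _ : ℕ, 0)) := by
    refine tendsto_tsum_of_dominated_convergence hsum (fun n ↦ ?_) ?_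
    · rw [tendsto_zero_iff_norm_tendsto_zero]
      simp only [hnorm]
      have h : Filter.Tendsto (fun z : ℂ ↦ Real.exp (-(2 * Real.pi * (n + 1) * z.im)))
          (Filter.comap Complex.im Filter.atTop) (nhds 0) :=
        Real.tendsto_exp_neg_atTop_nhds_zero.comp (him.const_mul_atTop (by positivity))
      simpa using h.const_mul (∑ d ∈ (n + 1).divisors, (d : ℝ))
    · filter_upwards [him.eventually_ge_atTop 1] with z hz n
      rw [hnorm]
      gcongr
  rw [tsum_zero] at hlim
  have h := (hlim.const_mul 24).const_sub 1
  rw [mul_zero, sub_zero] at h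
  refine h.congr' ?_
  filter_upwards [him.eventually_gt_atTop 0] with z hz
  exact (E2_ofComplex_eq_tsum hz).symm

open UpperHalfPlane in
/-- The quasi-modular transformation law of `E2` under the Möbius action of an integer matrix
of determinant one. -/
lemma E2_ofComplex_moebius {a b c d : ℤ} (h : a * d - b * c = 1) {z : ℂ} (hz : 0 < z.im) :
    EisensteinSeries.E2 (ofComplex ((a * z + b) / (c * z + d))) =
      (c * z + d) ^ 2 * EisensteinSeries.E2 (ofComplex z) -
        Real.pi * Complex.I / riemannZeta 2 * c * (c * z + d) := by
  let γ : Matrix.SpecialLinearGroup (Fin 2) ℤ := ⟨!![a, b; c, d], by simp [Matrix.det_fin_two, h]⟩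
  let τ : ℍ := ⟨z, hz⟩
  have hden : denom γ τ = c * z + d := by
    rw [ModularGroup.denom_apply]; simp [γ, τ]
  have hne : (c * z + d : ℂ) ≠ 0 := hden ▸ denom_ne_zero γ τ
  have hγ : ((γ • τ : ℍ) : ℂ) = (a * z + b) / (c * z + d) := by
    rw [coe_specialLinearGroup_apply]; simp [γ, τ]
  have key := congrFun (EisensteinSeries.E2_slash_action γ) τ
  rw [ModularForm.SL_slash_apply, hden] at key
  simp only [Pi.sub_apply, Pi.smul_apply, smul_eq_mul, EisensteinSeries.D2] at key
  rw [hden] at key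
  have hζ : riemannZeta 2 ≠ 0 := riemannZeta_ne_zero_of_one_lt_re (by simp)
  have hc : ((γ 1 0 : ℤ) : ℂ) = c := by simp [γ]
  rw [hc] at key
  rw [← hγ, ofComplex_apply, ofComplex_apply_of_im_pos hz]
  change _ = _ * EisensteinSeries.E2 τ - _
  rw [zpow_neg, ← div_eq_mul_inv, div_eq_iff (zpow_ne_zero _ hne)] at key
  rw [key]
  simp only [zpow_ofNat]
  field_simp

/-- With `E` the weight-2 Eisenstein series, `d, c` positive integers and
`x ∈ ℝ` fixed, writing `z = x + iy` and `w = z/(cz+1)`,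
`(cz+1)⁻² (E(w) - d·E(dw)) → 1 - gcd(c,d)²/d` as `y → ∞`. -/
theorem stmt11 (E : ℂ → ℂ)
    (hE : ∀ z : ℂ, 0 < z.im →
      E z = 1 - 24 * ∑' n : ℕ, (∑ d ∈ (n + 1).divisors, (d : ℂ)) *
        Complex.exp (2 * Real.pi * Complex.I * (n + 1) * z))
    (d c : ℕ) (hd : 0 < d) (hc : 0 < c) (x : ℝ) :
    Filter.Tendsto
      (fun y : ℝ =>
        ((c : ℂ) * ((x : ℂ) + (y : ℂ) * Complex.I) + 1) ^ (-2 : ℤ) *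
          (E (((x : ℂ) + (y : ℂ) * Complex.I) /
                ((c : ℂ) * ((x : ℂ) + (y : ℂ) * Complex.I) + 1)) -
            (d : ℂ) * E ((d : ℂ) * (((x : ℂ) + (y : ℂ) * Complex.I) /
                ((c : ℂ) * ((x : ℂ) + (y : ℂ) * Complex.I) + 1)))))
      Filter.atTop (nhds (1 - (Nat.gcd c d : ℂ) ^ 2 / (d : ℂ))) := by
  obtain ⟨g, d', c', hg, hd', hc'⟩ :
      ∃ g d' c' : ℕ, g = Nat.gcd c d ∧ d = g * d' ∧ c = g * c' :=
    ⟨_, d / Nat.gcd c d, c / Nat.gcd c d, rfl, (Nat.mul_div_cancel' (Nat.gcd_dvd_right c d)).symm,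
      (Nat.mul_div_cancel' (Nat.gcd_dvd_left c d)).symm⟩
  have hg0 : 0 < g := hg ▸ Nat.gcd_pos_of_pos_left d hc
  have hd0 : 0 < d' := Nat.pos_of_mul_pos_left (hd' ▸ hd)
  obtain ⟨s, q, hsq⟩ : ∃ s q : ℤ, d' * s - q * c' = 1 := by
    have h := Nat.gcd_eq_gcd_ab c d
    refine ⟨Nat.gcdB c d, -Nat.gcdA c d, ?_⟩
    have hgz : (g : ℤ) ≠ 0 := by exact_mod_cast hg0.ne'
    apply mul_left_cancel₀ hgz
    rw [← hg] at h
    have h1 : (d : ℤ) = g * d' := by exact_mod_cast hd'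
    have h2 : (c : ℤ) = g * c' := by exact_mod_cast hc'
    linear_combination -h - h2 * Nat.gcdA c d - h1 * Nat.gcdB c d
  rw [← hg]
  have hgC : (g : ℂ) ≠ 0 := by exact_mod_cast hg0.ne'
  have hdC : (d' : ℂ) ≠ 0 := by exact_mod_cast hd0.ne'
  have hdd : (d : ℂ) = g * d' := by exact_mod_cast hd'
  have hcc : (c : ℂ) = g * c' := by exact_mod_cast hc'
  have hsqC : (d' * s - q * c' : ℂ) = 1 := by exact_mod_cast hsq
  have hz_im (y : ℝ) : ((x : ℂ) + y * Complex.I).im = y := by simp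
  have hu_im (y : ℝ) : ((g * ((x : ℂ) + y * Complex.I) - q) / d').im = g * y / d' := by
    rw [Complex.div_natCast_im]
    simp
  have hz_lim := tendsto_E2_ofComplex.comp (Filter.tendsto_comap_iff.mpr
    (show Filter.Tendsto (Complex.im ∘ fun y : ℝ ↦ (x : ℂ) + y * Complex.I)
      Filter.atTop Filter.atTop from Filter.tendsto_id.congr fun y ↦ (hz_im y).symm))
  have hu_lim := tendsto_E2_ofComplex.comp (Filter.tendsto_comap_iff.mpr
    (show Filter.Tendsto (Complex.im ∘ fun y : ℝ ↦ (g * ((x : ℂ) + y * Complex.I) - q) / d')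
      Filter.atTop Filter.atTop from
        ((Filter.tendsto_id.const_mul_atTop (show (0 : ℝ) < g by positivity)).atTop_div_const
          (show (0 : ℝ) < d' by positivity)).congr fun y ↦ (hu_im y).symm))
  have hlim := hz_lim.sub (hu_lim.const_mul ((g : ℂ) ^ 2 / d))
  rw [mul_one] at hlim
  refine hlim.congr' ?_
  filter_upwards [Filter.eventually_gt_atTop 0] with y hy
  simp only [Function.comp_apply]
  have hz : 0 < ((x : ℂ) + y * Complex.I).im := by rwa [hz_im]
  have hu : 0 < ((g * ((x : ℂ) + y * Complex.I) - q) / d').im := by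
    rw [hu_im]
    positivity
  generalize (x : ℂ) + y * Complex.I = z at hz hu
  have hj : (c * z + 1 : ℂ) ≠ 0 := by
    intro h0
    have h1 := congrArg Complex.im h0
    simp [hc.ne', hz.ne'] at h1
  have hw : 0 < (z / (c * z + 1)).im := by
    have h1 : (z / (c * z + 1)).im = z.im / Complex.normSq (c * z + 1) := by
      rw [Complex.div_im]
      simp
      ring
    rw [h1]
    exact div_pos hz (Complex.normSq_pos.mpr hj)
  have hdw : 0 < (d * (z / (c * z + 1))).im := by
    rw [← nsmul_eq_mul, Complex.smul_im]
    positivity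
  have hEw : E (z / (c * z + 1)) =
      (c * z + 1) ^ 2 * EisensteinSeries.E2 (UpperHalfPlane.ofComplex z) -
        Real.pi * Complex.I / riemannZeta 2 * c * (c * z + 1) := by
    rw [hE _ hw, ← E2_ofComplex_eq_tsum hw]
    simpa using E2_ofComplex_moebius (a := 1) (b := 0) (c := c) (d := 1) (by simp) hz
  have hden : c' * ((g * z - q) / d') + s = (c * z + 1) / d' := by
    field_simp
    linear_combination hsqC - z * hcc
  have hEdw : E (d * (z / (c * z + 1))) =
      ((c * z + 1) / d') ^ 2 *
          EisensteinSeries.E2 (UpperHalfPlane.ofComplex ((g * z - q) / d')) -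
        Real.pi * Complex.I / riemannZeta 2 * c' * ((c * z + 1) / d') := by
    rw [hE _ hdw, ← E2_ofComplex_eq_tsum hdw]
    have h := E2_ofComplex_moebius (a := d') (b := q) (c := c') (d := s) hsq hu
    simp only [Int.cast_natCast] at h
    rw [hden] at h
    rw [← h]
    congr 2
    rw [hdd]
    field_simp
    ring
  rw [hEw, hEdw, hdd, zpow_neg, zpow_ofNat]
  generalize EisensteinSeries.E2 (UpperHalfPlane.ofComplex z) = A
  generalize EisensteinSeries.E2 (UpperHalfPlane.ofComplex ((g * z - q) / d')) = B
  generalize (c * z + 1 : ℂ) = j at hj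
  have hζ : riemannZeta 2 ≠ 0 := riemannZeta_ne_zero_of_one_lt_re (by simp)
  field_simp
  rw [hcc]
  ring
end
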